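/- Under the same random shard graph model with d ≥ 2 and d² ≤ C·n^{1/2} for a constant C > 0, the expected retraining cost is bounded below: E|M_x| = Ω(|S₁|·d²). -/

import Mathlib

open Finset in
/-- The nodes reached from the in-neighbourhood of `i₀`, self-loops included, when node `j` has
out-neighbours `E j`. -/
def reachedNodes {n : ℕ} (E : Fin n → Finset (Fin n)) (i₀ : Fin n) : Finset (Fin n) :=
  (univ.filter fun j => i₀ ∈ insert j (E j)).biUnion fun j => insert j (E j)

open Finset in
/-- All assignments of `d` out-neighbours, other than the node itself, to every node. -/
def outNeighborChoices (n d : ℕ) : Finset (Fin n → Finset (Fin n)) :=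
  Fintype.piFinset fun i => (univ.erase i).powersetCard d

lemma mem_outNeighborChoices {n d : ℕ} {E : Fin n → Finset (Fin n)} :
    E ∈ outNeighborChoices n d ↔ ∀ i, (E i).card = d ∧ i ∉ E i := by
  simp only [outNeighborChoices, Fintype.mem_piFinset, Finset.mem_powersetCard]
  refine forall_congr' fun i => ?_
  rw [Finset.subset_erase]
  simp [and_comm]

lemma card_outNeighborChoices (n d : ℕ) :
    (outNeighborChoices n d).card = (n - 1).choose d ^ n := by
  simp [outNeighborChoices, Finset.card_erase_of_mem]

lemma mem_reachedNodes {n : ℕ} {E : Fin n → Finset (Fin n)} {i₀ k j : Fin n}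
    (h₀ : i₀ ∈ E j) (hk : k ∈ E j) : k ∈ reachedNodes E i₀ := by
  simp only [reachedNodes, Finset.mem_biUnion, Finset.mem_filter, Finset.mem_univ, true_and]
  exact ⟨j, Finset.mem_insert_of_mem h₀, Finset.mem_insert_of_mem hk⟩

lemma insert_subset_reachedNodes {n : ℕ} (E : Fin n → Finset (Fin n)) (i₀ : Fin n) :
    insert i₀ (E i₀) ⊆ reachedNodes E i₀ :=
  Finset.subset_biUnion_of_mem (fun j => insert j (E j)) (by simp)

lemma card_filter_pair_powersetCard {ι : Type*} [DecidableEq ι] {t : Finset ι} {a b : ι}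
    (hab : a ≠ b) (ha : a ∈ t) (hb : b ∈ t) {d : ℕ} (hd : 2 ≤ d) :
    ((t.powersetCard d).filter fun e => a ∈ e ∧ b ∈ e).card = (t.card - 2).choose (d - 2) := by
  have h := Finset.card_filter_powersetCard_subset {a, b} t d
    (by simp [Finset.insert_subset_iff, ha, hb]) (by rw [Finset.card_pair hab]; exact hd)
  rw [Finset.card_pair hab] at h
  rw [← h]
  simp [Finset.insert_subset_iff]

lemma card_filter_notMem_reachedNodes_le {n d : ℕ} (hd : 2 ≤ d) {i₀ k : Fin n} (hk : k ≠ i₀) :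
    ((outNeighborChoices n d).filter fun E => k ∉ reachedNodes E i₀).card ≤
      (n - 1).choose d ^ 2 * ((n - 1).choose d - (n - 3).choose (d - 2)) ^ (n - 2) := by
  classical
  let A : Fin n → Finset (Finset (Fin n)) := fun i => (Finset.univ.erase i).powersetCard d
  have hA : ∀ i, (A i).card = (n - 1).choose d := fun i => by
    simp [A, Finset.card_erase_of_mem]
  let B : Fin n → Finset (Finset (Fin n)) := fun j =>
    if j ∈ ({i₀, k} : Finset (Fin n)) then A j else (A j).filter fun e => ¬(i₀ ∈ e ∧ k ∈ e)
  have hsub : ((outNeighborChoices n d).filter fun E => k ∉ reachedNodes E i₀) ⊆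
      Fintype.piFinset B := by
    intro E hE
    obtain ⟨hE, hkE⟩ := Finset.mem_filter.mp hE
    have hE' : ∀ i, E i ∈ A i := Fintype.mem_piFinset.mp hE
    refine Fintype.mem_piFinset.mpr fun j => ?_
    by_cases hj : j ∈ ({i₀, k} : Finset (Fin n))
    · simpa only [B, if_pos hj] using hE' j
    · simp only [B, if_neg hj, Finset.mem_filter]
      exact ⟨hE' j, fun h => hkE (mem_reachedNodes h.1 h.2)⟩
  have hB : ∀ j, (B j).card = if j ∈ ({i₀, k} : Finset (Fin n)) then (n - 1).choose d
      else (n - 1).choose d - (n - 3).choose (d - 2) := by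
    intro j
    by_cases hj : j ∈ ({i₀, k} : Finset (Fin n))
    · simp only [B, if_pos hj, hA]
    · simp only [B, if_neg hj]
      simp only [Finset.mem_insert, Finset.mem_singleton, not_or] at hj
      have h := Finset.card_filter_add_card_filter_not (s := A j) fun e => i₀ ∈ e ∧ k ∈ e
      rw [hA, card_filter_pair_powersetCard hk.symm (by simp [Ne.symm hj.1])
        (by simp [Ne.symm hj.2]) hd, Finset.card_erase_of_mem (Finset.mem_univ j),
        Finset.card_univ, Fintype.card_fin, show n - 1 - 2 = n - 3 by omega] at h
      omega
  refine (Finset.card_le_card hsub).trans_eq ?_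
  rw [Fintype.card_piFinset, Finset.prod_congr rfl fun j _ => hB j, Finset.prod_ite]
  have h1 : (Finset.univ.filter fun j => j ∈ ({i₀, k} : Finset (Fin n))) = {i₀, k} := by
    ext; simp
  have h2 : (Finset.univ.filter fun j => j ∉ ({i₀, k} : Finset (Fin n))) =
      ({i₀, k} : Finset (Fin n))ᶜ := by
    ext; simp
  rw [h1, h2, Finset.prod_const, Finset.prod_const, Finset.card_compl,
    Finset.card_pair hk.symm, Fintype.card_fin]

lemma one_sub_pow_le {q : ℝ} {m : ℕ} (h0 : 0 ≤ q) (h1 : q ≤ 1) (hm : m * q ≤ 1) :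
    (1 - q) ^ m ≤ 1 - m * q / 2 := by
  have hb : 1 + m * q ≤ (1 + q) ^ m := one_add_mul_le_pow (by linarith) m
  have hp : (1 - q) ^ m * (1 + q) ^ m ≤ 1 := by
    rw [← mul_pow]
    exact pow_le_one₀ (mul_nonneg (by linarith) (by linarith)) (by nlinarith)
  have hx : 0 ≤ (1 - q) ^ m := pow_nonneg (by linarith) m
  have hmq : 0 ≤ m * q := by positivity
  nlinarith [mul_le_mul_of_nonneg_left hb hx]

lemma choose_mul_mul_eq {n d : ℕ} (hn : 3 ≤ n) (hd : 2 ≤ d) :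
    ((n - 1).choose d : ℝ) * (d * (d - 1)) =
      (n - 1) * (n - 2) * ((n - 3).choose (d - 2) : ℝ) := by
  have h := congrArg (Nat.cast (R := ℝ)) (Nat.choose_mul (n := n - 1) hd)
  push_cast [Nat.cast_choose_two] at h
  rw [show n - 1 - 2 = n - 3 by omega, Nat.cast_sub (by omega : 1 ≤ n)] at h
  push_cast at h
  linarith

lemma card_filter_mem_reachedNodes_ge {n d : ℕ} (hd : 2 ≤ d) (hdn : d ≤ n - 1)
    (hsmall : (d : ℝ) ^ 2 ≤ n - 1) {i₀ k : Fin n} (hk : k ≠ i₀) :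
    ((n - 1).choose d : ℝ) ^ n * (d * (d - 1) / (n - 1) / 2) ≤
      ((outNeighborChoices n d).filter fun E => k ∈ reachedNodes E i₀).card := by
  have hn : 3 ≤ n := by omega
  have hn' : (3 : ℝ) ≤ n := by exact_mod_cast hn
  have hd' : (2 : ℝ) ≤ d := by exact_mod_cast hd
  have hN : (0 : ℝ) < (n - 1).choose d := by exact_mod_cast Nat.choose_pos hdn
  have hMN : ((n - 1).choose d : ℝ) * (d * (d - 1)) = _ := choose_mul_mul_eq hn hd
  have hcompl := card_filter_notMem_reachedNodes_le hd hk
  have hsplit := Finset.card_filter_add_card_filter_not (s := outNeighborChoices n d)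
    fun E => k ∈ reachedNodes E i₀
  rw [card_outNeighborChoices] at hsplit
  set N := (n - 1).choose d with hNdef
  set M := (n - 3).choose (d - 2)
  have hq : (M : ℝ) / N = d * (d - 1) / ((n - 1) * (n - 2)) := by
    rw [div_eq_div_iff hN.ne' (by nlinarith)]
    linarith
  have hcast : ((n - 2 : ℕ) : ℝ) = n - 2 := by
    rw [Nat.cast_sub (by omega)]; norm_num
  have hmq : ((n - 2 : ℕ) : ℝ) * (M / N) = d * (d - 1) / (n - 1) := by
    rw [hq, hcast]
    have : (n : ℝ) - 2 ≠ 0 := by linarith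
    have : (n : ℝ) - 1 ≠ 0 := by linarith
    field_simp
  have hmq1 : ((n - 2 : ℕ) : ℝ) * (M / N) ≤ 1 := by
    rw [hmq, div_le_one (by linarith)]
    nlinarith
  have hq1 : (M : ℝ) / N ≤ 1 := by
    refine le_trans ?_ hmq1
    rw [hcast]
    exact le_mul_of_one_le_left (by positivity) (by linarith)
  have hle : M ≤ N := by
    rw [div_le_one hN] at hq1
    exact_mod_cast hq1
  have hpow := one_sub_pow_le (by positivity) hq1 hmq1
  rw [hmq] at hpow
  have hreal : (((outNeighborChoices n d).filter fun E => k ∉ reachedNodes E i₀).card : ℝ) ≤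
      (N : ℝ) ^ n * (1 - d * (d - 1) / (n - 1) / 2) := by
    calc _ ≤ (N : ℝ) ^ 2 * ((N : ℝ) - M) ^ (n - 2) := by
          rw [← Nat.cast_sub hle]
          exact_mod_cast hcompl
      _ = (N : ℝ) ^ n * (1 - M / N) ^ (n - 2) := by
          rw [one_sub_div hN.ne', div_pow]
          have : (N : ℝ) ^ n = N ^ 2 * N ^ (n - 2) := by
            rw [← pow_add]; congr 1; omega
          rw [this]
          field_simp
      _ ≤ _ := by gcongr
  have hsplit' := congrArg (Nat.cast (R := ℝ)) hsplit
  push_cast at hsplit'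
  linarith

lemma sum_card_reachedNodes_ge {n d : ℕ} (hd : 2 ≤ d) (hdn : d ≤ n - 1)
    (hsmall : (d : ℝ) ^ 2 ≤ n - 1) (i₀ : Fin n) :
    ((outNeighborChoices n d).card : ℝ) * (d ^ 2 / 4) ≤
      ∑ E ∈ outNeighborChoices n d, ((reachedNodes E i₀).card : ℝ) := by
  have hn' : (3 : ℝ) ≤ n := by exact_mod_cast (by omega : 3 ≤ n)
  have hd' : (2 : ℝ) ≤ d := by exact_mod_cast hd
  have hcomm : ∑ E ∈ outNeighborChoices n d, (reachedNodes E i₀).card =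
      ∑ k, ((outNeighborChoices n d).filter fun E => k ∈ reachedNodes E i₀).card := by
    simp only [Finset.card_eq_sum_ones (Finset.filter _ _), Finset.sum_filter]
    rw [Finset.sum_comm]
    simp
  rw [← Nat.cast_sum, hcomm, Nat.cast_sum, card_outNeighborChoices]
  calc _ ≤ (n - 1 : ℝ) * (((n - 1).choose d : ℝ) ^ n * (d * (d - 1) / (n - 1) / 2)) := by
        have : (n : ℝ) - 1 ≠ 0 := by linarith
        have e : (n - 1 : ℝ) * (((n - 1).choose d : ℝ) ^ n * (d * (d - 1) / (n - 1) / 2)) =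
            ((n - 1).choose d : ℝ) ^ n * (d * (d - 1) / 2) := by field_simp
        rw [e]
        push_cast
        exact mul_le_mul_of_nonneg_left (by nlinarith) (by positivity)
    _ = ∑ _k ∈ Finset.univ.erase i₀,
          ((n - 1).choose d : ℝ) ^ n * (d * (d - 1) / (n - 1) / 2) := by
        rw [Finset.sum_const, Finset.card_erase_of_mem (Finset.mem_univ _), nsmul_eq_mul,
          Finset.card_univ, Fintype.card_fin, Nat.cast_sub (by omega), Nat.cast_one]
    _ ≤ ∑ k ∈ Finset.univ.erase i₀,
          (((outNeighborChoices n d).filter fun E => k ∈ reachedNodes E i₀).card : ℝ) :=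
        Finset.sum_le_sum fun k hk =>
          card_filter_mem_reachedNodes_ge hd hdn hsmall (Finset.ne_of_mem_erase hk)
    _ ≤ _ := Finset.sum_le_sum_of_subset_of_nonneg (Finset.erase_subset _ _)
        fun _ _ _ => Nat.cast_nonneg _

lemma mul_card_reachedNodes_le {n d s : ℕ} (hd : 2 ≤ d) {α : Type*} [DecidableEq α]
    {S : Fin n → Finset α} (hS : ∀ i j : Fin n, i ≠ j → Disjoint (S i) (S j))
    (hs : ∀ i, (S i).card = s) {i₀ : Fin n} {x : α} (hx : x ∈ S i₀)
    {E : Fin n → Finset (Fin n)} (hE : (E i₀).card = d) :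
    (s : ℝ) * (reachedNodes E i₀).card / 2 ≤
      (((Finset.univ.filter fun j => i₀ ∈ insert j (E j)).biUnion fun j =>
        (insert j (E j)).biUnion S).erase x).card := by
  rw [← Finset.biUnion_biUnion]
  change _ ≤ ((((reachedNodes E i₀).biUnion S).erase x).card : ℝ)
  have hi₀ : i₀ ∈ reachedNodes E i₀ :=
    insert_subset_reachedNodes E i₀ (Finset.mem_insert_self _ _)
  have hT : 2 ≤ (reachedNodes E i₀).card :=
    (hE ▸ hd).trans (Finset.card_le_card
      ((Finset.subset_insert _ _).trans (insert_subset_reachedNodes E i₀)))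
  have hs1 : 1 ≤ s := hs i₀ ▸ Finset.card_pos.mpr ⟨x, hx⟩
  have h := Finset.card_erase_add_one (Finset.mem_biUnion.mpr ⟨i₀, hi₀, hx⟩ :
    x ∈ (reachedNodes E i₀).biUnion S)
  rw [Finset.card_biUnion fun i _ j _ hij => hS i j hij, Finset.sum_congr rfl fun i _ => hs i,
    Finset.sum_const, smul_eq_mul] at h
  have h' := congrArg (Nat.cast (R := ℝ)) h
  push_cast at h'
  have hT' : (2 : ℝ) ≤ (reachedNodes E i₀).card := by exact_mod_cast hT
  have hs1' : (1 : ℝ) ≤ s := by exact_mod_cast hs1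
  nlinarith

lemma const_mul_sqrt_le {C : ℝ} (hC : 0 < C) {n : ℕ} (hn : ⌈4 * C ^ 2⌉₊ + 2 ≤ n) :
    C * (n : ℝ) ^ ((1 : ℝ) / 2) ≤ n - 1 := by
  rw [← Real.sqrt_eq_rpow]
  have h1 : 4 * C ^ 2 + 2 ≤ n :=
    (by gcongr; exact Nat.le_ceil _ : 4 * C ^ 2 + 2 ≤ (⌈4 * C ^ 2⌉₊ : ℝ) + 2).trans
      (by exact_mod_cast hn)
  have h2 : 2 * C ≤ √(n : ℝ) := Real.le_sqrt_of_sq_le (by nlinarith)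
  nlinarith [Real.sq_sqrt (Nat.cast_nonneg n : (0 : ℝ) ≤ n), Real.sqrt_nonneg (n : ℝ), sq_nonneg C]


/-- Lower bound on the expected retraining cost in the random-connectivity shard graph:
for every `C > 0` there is a constant `c > 0` (depending only on `C`) and a threshold
`n₀` such that for all `n ≥ n₀`, degree `d` with `2 ≤ d`, `d ≤ n - 1` and
`d² ≤ C·n^{1/2}`, and pairwise disjoint shards of equal size `s`, the expected size of
`M_x` is at least `c * s * d²`, i.e. `E|M_x| = Ω(s d²)`. -/
theorem stmt3 (C : ℝ) (hC : 0 < C) :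
    ∃ c : ℝ, 0 < c ∧ ∃ n₀ : ℕ, ∀ n : ℕ, n₀ ≤ n →
      ∀ d s : ℕ, 2 ≤ d → d ≤ n - 1 → (d : ℝ) ^ 2 ≤ C * (n : ℝ) ^ ((1 : ℝ) / 2) →
      ∀ (α : Type) [DecidableEq α], ∀ S : Fin n → Finset α,
        (∀ i j : Fin n, i ≠ j → Disjoint (S i) (S j)) →
        (∀ i, (S i).card = s) →
        ∀ (i₀ : Fin n) (x : α), x ∈ S i₀ →
        c * (s : ℝ) * (d : ℝ) ^ 2 ≤
          (∑ ω : {E : Fin n → Finset (Fin n) // ∀ i, (E i).card = d ∧ i ∉ E i},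
              ((((Finset.univ.filter fun j => i₀ ∈ insert j (ω.1 j)).biUnion fun j =>
                  (insert j (ω.1 j)).biUnion S).erase x).card : ℝ)) /
            (Fintype.card {E : Fin n → Finset (Fin n) // ∀ i, (E i).card = d ∧ i ∉ E i}) := by
  refine ⟨1 / 8, by norm_num, ⌈4 * C ^ 2⌉₊ + 2, ?_⟩
  intro n hn d s hd hdn hdC α _ S hS hs i₀ x hx
  rw [Fintype.card_of_subtype (outNeighborChoices n d) fun E => mem_outNeighborChoices,
    ← Finset.sum_subtype (outNeighborChoices n d) (fun E => mem_outNeighborChoices)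
      fun E => ((((Finset.univ.filter fun j => i₀ ∈ insert j (E j)).biUnion fun j =>
        (insert j (E j)).biUnion S).erase x).card : ℝ),
    le_div_iff₀ (by
      rw [card_outNeighborChoices]
      exact_mod_cast pow_pos (Nat.choose_pos hdn) n)]
  have h := sum_card_reachedNodes_ge hd hdn (hdC.trans (const_mul_sqrt_le hC hn)) i₀
  calc _ = (s : ℝ) / 2 * ((outNeighborChoices n d).card * (d ^ 2 / 4)) := by ring
    _ ≤ s / 2 * ∑ E ∈ outNeighborChoices n d, ((reachedNodes E i₀).card : ℝ) := by gcongr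
    _ = ∑ E ∈ outNeighborChoices n d, (s : ℝ) * (reachedNodes E i₀).card / 2 := by
        rw [Finset.mul_sum]
        exact Finset.sum_congr rfl fun _ _ => by ring
    _ ≤ _ := Finset.sum_le_sum fun E hE =>
        mul_card_reachedNodes_le hd hS hs hx (mem_outNeighborChoices.mp hE i₀).1
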